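/- arXiv:2106.07842 — 3 statements merged into one kernel-verified Lean document; each statement's English description precedes it below -/
import Mathlib

section
/- Power-law case of the basic kernel integral bound: let m ≥ 0 and n ≥ m + 2 be integers. There exist constants C > 0 and ε₀ > 0, depending only on n, c_Γ, and κ_max, such that for all 0 < ε < ε₀, 0 < δ < ε₀, every s ∈ ℝ/ℤ and θ ∈ [0,2π), ∫_{−1/2}^{1/2} |s̄|^m / (|R(s,s̄,θ)|² + δ²)^{n/2} ds̄ ≤ C (ε² + δ²)^{(m+1−n)/2}. -/
open MeasureTheory

noncomputable section

local notation "⟪" x ", " y "⟫" => @inner ℝ _ _ x y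

abbrev V3 : Type := EuclideanSpace ℝ (Fin 3)

/-- The `C⁰` (sup) norm of a function `ℝ/ℤ → ℝ³`. -/
def C0norm (f : ℝ → V3) : ℝ := ⨆ s : ℝ, ‖f s‖

/-- The `C¹` norm of a function `ℝ/ℤ → ℝ³`. -/
def C1norm (f : ℝ → V3) : ℝ := C0norm f + C0norm (deriv f)

/-- The radial unit vector `e_ρ(s,θ) = cos θ e_{n1}(s) + sin θ e_{n2}(s)`. -/
def ePerp (en1 en2 : ℝ → V3) (s θ : ℝ) : V3 :=
  Real.cos θ • en1 s + Real.sin θ • en2 s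

/-- `R(s, s̄, θ) = X(s) + ε e_ρ(s,θ) − X(s − s̄)`. -/
def Rvec (X en1 en2 : ℝ → V3) (ε s sb θ : ℝ) : V3 :=
  X s + ε • ePerp en1 en2 s θ - X (s - sb)

/-- The slender-body geometry hypotheses: `X : ℝ/ℤ → ℝ³` is a `C²` closed curve
parameterized by arclength, non-self-intersecting with constant `cΓ`, with curvature
bounded by `κmax`, together with a `C¹` orthonormal frame `(X', en1, en2)`. -/
structure SlenderGeom (cΓ κmax : ℝ) (X en1 en2 : ℝ → V3) : Prop where
  smooth : ContDiff ℝ 2 X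
  periodicX : ∀ s, X (s + 1) = X s
  arclength : ∀ s, ‖deriv X s‖ = 1
  no_self_intersect : ∀ s t : ℝ, |s - t| ≤ 1 / 2 → cΓ * |s - t| ≤ ‖X s - X t‖
  curvature_max : ∀ s, ‖deriv (deriv X) s‖ ≤ κmax
  en1_smooth : ContDiff ℝ 1 en1
  en2_smooth : ContDiff ℝ 1 en2
  en1_periodic : ∀ s, en1 (s + 1) = en1 s
  en2_periodic : ∀ s, en2 (s + 1) = en2 s
  en1_unit : ∀ s, ‖en1 s‖ = 1
  en2_unit : ∀ s, ‖en2 s‖ = 1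
  es_en1 : ∀ s, ⟪deriv X s, en1 s⟫ = 0
  es_en2 : ∀ s, ⟪deriv X s, en2 s⟫ = 0
  en1_en2 : ∀ s, ⟪en1 s, en2 s⟫ = 0

/-- The singular Stokeslet `S(y) v = v/|y| + (y·v) y/|y|³`. -/
def stokeslet (y v : V3) : V3 := ‖y‖⁻¹ • v + (‖y‖ ^ 3)⁻¹ • ⟪y, v⟫ • y

/-- The singular doublet `D(y) v = v/|y|³ − 3 (y·v) y/|y|⁵`. -/
def doubletK (y v : V3) : V3 := (‖y‖ ^ 3)⁻¹ • v - (3 * (‖y‖ ^ 5)⁻¹) • ⟪y, v⟫ • y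

/-- The regularized Stokeslet `S_δ(y) v`. -/
def stokesletReg (δ : ℝ) (y v : V3) : V3 :=
  ((‖y‖ ^ 2 + δ ^ 2) ^ ((1 : ℝ) / 2))⁻¹ • v
    + ((‖y‖ ^ 2 + δ ^ 2) ^ ((3 : ℝ) / 2))⁻¹ • (⟪y, v⟫ • y + δ ^ 2 • v)

/-- The regularized doublet `D_δ(y) v`. -/
def doubletReg (δ : ℝ) (y v : V3) : V3 :=
  ((‖y‖ ^ 2 + δ ^ 2) ^ ((3 : ℝ) / 2))⁻¹ • v
    - (3 * ((‖y‖ ^ 2 + δ ^ 2) ^ ((5 : ℝ) / 2))⁻¹) • (⟪y, v⟫ • y + δ ^ 2 • v)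

/-- The classical slender-body velocity `u^SB(x)` with doublet coefficient `ε²/2`. -/
def uSB (X f : ℝ → V3) (ε : ℝ) (x : V3) : V3 :=
  (8 * Real.pi)⁻¹ • ∫ t in (0:ℝ)..1,
    (stokeslet (x - X t) (f t) + (ε ^ 2 / 2) • doubletK (x - X t) (f t))

/-- The regularized slender-body velocity with doublet coefficient `β`. -/
def uReg (X f : ℝ → V3) (β δ : ℝ) (x : V3) : V3 :=
  (8 * Real.pi)⁻¹ • ∫ t in (0:ℝ)..1,
    (stokesletReg δ (x - X t) (f t) + β • doubletReg δ (x - X t) (f t))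

/-- The Keller–Rubinow classical centerline velocity `u^SB_C(X(s))`. -/
def uSBC (X f : ℝ → V3) (ε s : ℝ) : V3 :=
  (8 * Real.pi)⁻¹ •
    ((f s - (3 : ℝ) • ⟪deriv X s, f s⟫ • deriv X s
        - (2 * Real.log (Real.pi * ε / 4)) • (f s + ⟪deriv X s, f s⟫ • deriv X s))
      + ∫ t in (0:ℝ)..1,
          ((‖X s - X t‖⁻¹ • f t
              + (‖X s - X t‖ ^ 3)⁻¹ • ⟪X s - X t, f t⟫ • (X s - X t))
            - |Real.sin (Real.pi * (s - t)) / Real.pi|⁻¹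
                • (f s + ⟪deriv X s, f s⟫ • deriv X s)))

/-- The regularized pressure `p^δ(x)`. -/
def pReg (X f : ℝ → V3) (δ : ℝ) (x : V3) : ℝ :=
  (4 * Real.pi)⁻¹ * ∫ t in (0:ℝ)..1,
    (⟪x - X t, f t⟫ * ((‖x - X t‖ ^ 2 + δ ^ 2) ^ ((3 : ℝ) / 2))⁻¹
      + 3 * δ ^ 2 * ⟪x - X t, f t⟫ * (2 * (‖x - X t‖ ^ 2 + δ ^ 2) ^ ((5 : ℝ) / 2))⁻¹)

/-- The symmetric strain tensor `E(u) = (∇u + (∇u)ᵀ)/2` applied to the vector `n`. -/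
def strainApply (u : V3 → V3) (x n : V3) : V3 :=
  (2 : ℝ)⁻¹ • (fderiv ℝ u x n + gradient (fun y => ⟪u y, n⟫) x)

/-- The surface Jacobian `J_ε(s,θ) = ε(1 − ε(κ₁ cos θ + κ₂ sin θ))`. -/
def Jfac (X en1 en2 : ℝ → V3) (ε s θ : ℝ) : ℝ :=
  ε * (1 - ε * (⟪deriv (deriv X) s, en1 s⟫ * Real.cos θ
      + ⟪deriv (deriv X) s, en2 s⟫ * Real.sin θ))

/-- The regularized surface force density
`f^δ(s) = ∫_0^{2π} (2 E(u^δ) n − p^δ n) J_ε dθ`, with `n = −e_ρ`. -/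
def fReg (X en1 en2 f : ℝ → V3) (ε δ s : ℝ) : V3 :=
  ∫ θ in (0:ℝ)..(2 * Real.pi),
    Jfac X en1 en2 ε s θ •
      ((2 : ℝ) • strainApply (uReg X f ((ε ^ 2 + δ ^ 2) / 2) δ)
          (X s + ε • ePerp en1 en2 s θ) (-ePerp en1 en2 s θ)
        - pReg X f δ (X s + ε • ePerp en1 en2 s θ) • (-ePerp en1 en2 s θ))

/-- The vector field `d_n^δ[f](x)`. -/
def dReg (X f : ℝ → V3) (δ : ℝ) (n : ℕ) (x : V3) : V3 :=
  (8 * Real.pi)⁻¹ • ∫ t in (0:ℝ)..1,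
    (δ ^ 2 * ((‖x - X t‖ ^ 2 + δ ^ 2) ^ ((n : ℝ) / 2))⁻¹) • f t

/-- The scalar field `d_5^δ[f·R](x)`. -/
def dRegP (X f : ℝ → V3) (δ : ℝ) (x : V3) : ℝ :=
  (8 * Real.pi)⁻¹ * ∫ t in (0:ℝ)..1,
    δ ^ 2 * ⟪x - X t, f t⟫ * ((‖x - X t‖ ^ 2 + δ ^ 2) ^ ((5 : ℝ) / 2))⁻¹

/-- The extra force contribution
`F^δ(s) = ∫_0^{2π} (2E(d₃^δ[f])n − 3(ε²+δ²)E(d₅^δ[f])n − 3 d₅^δ[f·R] n) J_ε dθ`. -/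
def Fextra (X en1 en2 f : ℝ → V3) (ε δ s : ℝ) : V3 :=
  ∫ θ in (0:ℝ)..(2 * Real.pi),
    Jfac X en1 en2 ε s θ •
      ((2 : ℝ) • strainApply (dReg X f δ 3) (X s + ε • ePerp en1 en2 s θ)
          (-ePerp en1 en2 s θ)
        - (3 * (ε ^ 2 + δ ^ 2)) • strainApply (dReg X f δ 5)
            (X s + ε • ePerp en1 en2 s θ) (-ePerp en1 en2 s θ)
        - (3 * dRegP X f δ (X s + ε • ePerp en1 en2 s θ)) • (-ePerp en1 en2 s θ))

lemma integral_inv_sq_add_sq_le {η : ℝ} (hη : 0 < η) (a b : ℝ) :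
    ∫ t in a..b, (t ^ 2 + η ^ 2)⁻¹ ≤ Real.pi * η⁻¹ := by
  have hderiv : ∀ t ∈ Set.uIcc a b,
      HasDerivAt (fun t => η⁻¹ * Real.arctan (t / η)) (t ^ 2 + η ^ 2)⁻¹ t := by
    intro t _
    refine ((((hasDerivAt_id' t).div_const η).arctan).const_mul η⁻¹).congr_deriv ?_
    field_simp
    ring
  have hint : IntervalIntegrable (fun t : ℝ => (t ^ 2 + η ^ 2)⁻¹) volume a b := by
    apply Continuous.intervalIntegrable
    refine Continuous.inv₀ (by fun_prop) fun t => ?_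
    positivity
  rw [intervalIntegral.integral_eq_sub_of_hasDerivAt hderiv hint, ← mul_sub, mul_comm]
  refine mul_le_mul_of_nonneg_right ?_ (inv_pos.2 hη).le
  linarith [Real.arctan_lt_pi_div_two (b / η), Real.neg_pi_div_two_lt_arctan (a / η)]

lemma norm_sub_sub_smul_deriv_le {E : Type*} [NormedAddCommGroup E] [NormedSpace ℝ E]
    {X : ℝ → E} (hX : ContDiff ℝ 2 X) {κ : ℝ} (hκ : ∀ s, ‖deriv (deriv X) s‖ ≤ κ) (s t : ℝ) :
    ‖X s - X (s - t) - t • deriv X s‖ ≤ κ * t ^ 2 := by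
  have hX1 : Differentiable ℝ X := hX.differentiable (by norm_num)
  have hX2 : Differentiable ℝ (deriv X) :=
    ((contDiff_succ_iff_deriv (n := 1)).1 (by norm_num; exact hX)).2.2.differentiable (by norm_num)
  have hκ0 : 0 ≤ κ := (norm_nonneg _).trans (hκ s)
  have hlip (u : ℝ) : ‖deriv X u - deriv X s‖ ≤ κ * ‖u - s‖ :=
    convex_univ.norm_image_sub_le_of_norm_deriv_le (fun x _ => hX2 x) (fun x _ => hκ x)
      (Set.mem_univ s) (Set.mem_univ u)
  have hmv := (convex_closedBall s |t|).norm_image_sub_le_of_norm_hasDerivWithin_le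
    (f := fun u => X u - u • deriv X s) (f' := fun u => deriv X u - deriv X s)
    (C := κ * |t|) (x := s - t) (y := s)
    (fun u _ => by
      have hd := (hX1 u).hasDerivAt.fun_sub ((hasDerivAt_id' u).smul_const (deriv X s))
      rw [one_smul] at hd
      exact hd.hasDerivWithinAt)
    (fun u hu => (hlip u).trans
      (mul_le_mul_of_nonneg_left (by simpa [dist_eq_norm] using hu) hκ0))
    (by simp) (by simp)
  calc ‖X s - X (s - t) - t • deriv X s‖
      = ‖X s - s • deriv X s - (X (s - t) - (s - t) • deriv X s)‖ := by
        congr 1; module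
    _ ≤ κ * |t| * ‖s - (s - t)‖ := hmv
    _ = κ * t ^ 2 := by
        rw [sub_sub_cancel, Real.norm_eq_abs, mul_assoc, abs_mul_abs_self, sq]

lemma SlenderGeom.norm_ePerp {cΓ κmax : ℝ} {X en1 en2 : ℝ → V3}
    (h : SlenderGeom cΓ κmax X en1 en2) (s θ : ℝ) : ‖ePerp en1 en2 s θ‖ = 1 := by
  have hsq : ‖ePerp en1 en2 s θ‖ ^ 2 = 1 := by
    rw [ePerp, norm_add_sq_real, norm_smul, norm_smul, inner_smul_left, inner_smul_right,
      h.en1_en2, h.en1_unit, h.en2_unit]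
    simp
  exact (pow_eq_one_iff_of_nonneg (norm_nonneg _) two_ne_zero).1 hsq

lemma SlenderGeom.inner_deriv_ePerp {cΓ κmax : ℝ} {X en1 en2 : ℝ → V3}
    (h : SlenderGeom cΓ κmax X en1 en2) (s θ : ℝ) : ⟪deriv X s, ePerp en1 en2 s θ⟫ = 0 := by
  rw [ePerp, inner_add_right, inner_smul_right, inner_smul_right, h.es_en1, h.es_en2]
  simp

/-- Near the centerline, `|R|²` dominates `s̄² + ε²` up to constants. -/
lemma SlenderGeom.le_norm_Rvec_sq {cΓ κmax : ℝ} {X en1 en2 : ℝ → V3}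
    (h : SlenderGeom cΓ κmax X en1 en2) (hcΓ : 0 < cΓ) {ε : ℝ} (hε : 0 < ε)
    (hεκ : 4 * ε * κmax ≤ cΓ ^ 2) (s θ : ℝ) {t : ℝ} (ht : |t| ≤ 1 / 2) :
    cΓ ^ 2 / 2 * t ^ 2 + ε ^ 2 ≤ ‖Rvec X en1 en2 ε s t θ‖ ^ 2 := by
  set e := ePerp en1 en2 s θ with he
  have hD : cΓ ^ 2 * t ^ 2 ≤ ‖X s - X (s - t)‖ ^ 2 := by
    have h1 := h.no_self_intersect s (s - t) (by simpa using ht)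
    rw [sub_sub_cancel] at h1
    have h2 := pow_le_pow_left₀ (by positivity) h1 2
    rwa [mul_pow, sq_abs] at h2
  have hinner : |⟪X s - X (s - t), e⟫| ≤ κmax * t ^ 2 := by
    have h1 : ⟪X s - X (s - t), e⟫ = ⟪X s - X (s - t) - t • deriv X s, e⟫ := by
      rw [inner_sub_left _ (t • deriv X s), inner_smul_left, he, h.inner_deriv_ePerp]
      simp
    rw [h1]
    refine (abs_real_inner_le_norm _ _).trans ?_
    rw [he, h.norm_ePerp, mul_one]
    exact norm_sub_sub_smul_deriv_le h.smooth h.curvature_max s t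
  have hR : Rvec X en1 en2 ε s t θ = (X s - X (s - t)) + ε • e := by
    rw [Rvec]; abel
  rw [hR, norm_add_sq_real, inner_smul_right, norm_smul, he, h.norm_ePerp, ← he,
    Real.norm_eq_abs, mul_one, sq_abs]
  have h3 := (abs_le.1 hinner).1
  have h4 : ε * -(κmax * t ^ 2) ≤ ε * ⟪X s - X (s - t), e⟫ :=
    mul_le_mul_of_nonneg_left h3 hε.le
  nlinarith [mul_le_mul_of_nonneg_right hεκ (sq_nonneg t)]

lemma abs_pow_mul_inv_rpow_le {m n : ℕ} (hmn : m + 2 ≤ n) {a t E B : ℝ} (ha : 0 < a)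
    (hE : 0 < E) (hB : a * (t ^ 2 + E) ≤ B) :
    |t| ^ m * (B ^ ((n : ℝ) / 2))⁻¹
      ≤ (a ^ ((n : ℝ) / 2))⁻¹ * (E ^ (((n : ℝ) - m - 2) / 2))⁻¹ * (t ^ 2 + E)⁻¹ := by
  have hn : (m : ℝ) + 2 ≤ n := by exact_mod_cast hmn
  have hQ : 0 < t ^ 2 + E := by positivity
  have hBpos : 0 < B := (mul_pos ha hQ).trans_le hB
  have htm : |t| ^ m ≤ (t ^ 2 + E) ^ ((m : ℝ) / 2) := by
    have h1 : |t| ^ m = (t ^ 2) ^ ((m : ℝ) / 2) := by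
      rw [← sq_abs, ← Real.rpow_natCast_mul (abs_nonneg t), ← Real.rpow_natCast]
      congr 1
      push_cast
      ring
    rw [h1]
    exact Real.rpow_le_rpow (sq_nonneg t) (by linarith) (by positivity)
  have hEQ : E ^ (((n : ℝ) - m - 2) / 2) ≤ (t ^ 2 + E) ^ (((n : ℝ) - m - 2) / 2) :=
    Real.rpow_le_rpow hE.le (by linarith [sq_nonneg t]) (by linarith)
  have hsplit : (t ^ 2 + E) ^ ((n : ℝ) / 2) = (t ^ 2 + E) ^ ((m : ℝ) / 2) *
      (t ^ 2 + E) ^ (((n : ℝ) - m - 2) / 2) * (t ^ 2 + E) := by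
    conv_rhs => rw [← Real.rpow_add hQ, ← Real.rpow_add_one hQ.ne']
    congr 1
    ring
  have hBn : a ^ ((n : ℝ) / 2) * (t ^ 2 + E) ^ ((n : ℝ) / 2) ≤ B ^ ((n : ℝ) / 2) := by
    rw [← Real.mul_rpow ha.le hQ.le]
    exact Real.rpow_le_rpow (by positivity) hB (by positivity)
  rw [← mul_inv, ← mul_inv, ← div_eq_mul_inv, div_le_iff₀ (by positivity), inv_mul_eq_div,
    le_div_iff₀ (by positivity)]
  calc |t| ^ m * (a ^ ((n : ℝ) / 2) * E ^ (((n : ℝ) - m - 2) / 2) * (t ^ 2 + E))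
      ≤ (t ^ 2 + E) ^ ((m : ℝ) / 2) * (a ^ ((n : ℝ) / 2) *
          (t ^ 2 + E) ^ (((n : ℝ) - m - 2) / 2) * (t ^ 2 + E)) := by gcongr
    _ = a ^ ((n : ℝ) / 2) * (t ^ 2 + E) ^ ((n : ℝ) / 2) := by rw [hsplit]; ring
    _ ≤ B ^ ((n : ℝ) / 2) := hBn

/-- Power-law case of the basic kernel integral bound: for `n ≥ m + 2`,
`∫_{−1/2}^{1/2} |s̄|^m/(|R|²+δ²)^{n/2} ds̄ ≤ C (ε²+δ²)^{(m+1−n)/2}`. -/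
theorem kernel_integral_power_bound (m n : ℕ) (hmn : m + 2 ≤ n) (cΓ κmax : ℝ)
    (hcΓ : 0 < cΓ) :
    ∃ C > 0, ∃ ε₀ > 0,
      ∀ X en1 en2 : ℝ → V3, SlenderGeom cΓ κmax X en1 en2 →
      ∀ ε δ : ℝ, 0 < ε → ε < ε₀ → 0 < δ → δ < ε₀ →
      ∀ s θ : ℝ,
        (∫ sb in (-(1:ℝ)/2)..(1/2),
            |sb| ^ m * ((‖Rvec X en1 en2 ε s sb θ‖ ^ 2 + δ ^ 2) ^ ((n : ℝ) / 2))⁻¹)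
          ≤ C * (ε ^ 2 + δ ^ 2) ^ (((m : ℝ) + 1 - n) / 2) := by
  set a : ℝ := min 1 (cΓ ^ 2 / 2) with ha_def
  have ha : 0 < a := lt_min one_pos (by positivity)
  refine ⟨(a ^ ((n : ℝ) / 2))⁻¹ * Real.pi, by positivity, cΓ ^ 2 / (4 * (|κmax| + 1)),
    by positivity, ?_⟩
  intro X en1 en2 h ε δ hε hε₀ hδ _ s θ
  have hεκ : 4 * ε * κmax ≤ cΓ ^ 2 := by
    rw [lt_div_iff₀ (by positivity)] at hε₀
    nlinarith [mul_le_mul_of_nonneg_left (le_abs_self κmax) hε.le]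
  have hE : 0 < ε ^ 2 + δ ^ 2 := by positivity
  set E := ε ^ 2 + δ ^ 2 with hE_def
  have hbase (t : ℝ) (ht : |t| ≤ 1 / 2) :
      a * (t ^ 2 + E) ≤ ‖Rvec X en1 en2 ε s t θ‖ ^ 2 + δ ^ 2 := by
    have h1 := h.le_norm_Rvec_sq hcΓ hε hεκ s θ ht
    have h2 : a * t ^ 2 ≤ cΓ ^ 2 / 2 * t ^ 2 :=
      mul_le_mul_of_nonneg_right (min_le_right _ _) (sq_nonneg t)
    have h3 : a * E ≤ 1 * E := mul_le_mul_of_nonneg_right (min_le_left _ _) hE.le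
    linarith
  have hcont : Continuous fun sb : ℝ =>
      |sb| ^ m * ((‖Rvec X en1 en2 ε s sb θ‖ ^ 2 + δ ^ 2) ^ ((n : ℝ) / 2))⁻¹ := by
    have hX := h.smooth.continuous
    have hR : Continuous fun sb : ℝ => ‖Rvec X en1 en2 ε s sb θ‖ ^ 2 + δ ^ 2 := by
      unfold Rvec
      fun_prop
    refine (by fun_prop : Continuous fun sb : ℝ => |sb| ^ m).mul
      ((hR.rpow_const fun _ => Or.inr (by positivity)).inv₀ fun _ => ?_)
    positivity
  have hcont' : Continuous fun t : ℝ => (t ^ 2 + E)⁻¹ :=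
    Continuous.inv₀ (by fun_prop) fun t => by positivity
  have hpi : ∫ t in (-(1:ℝ)/2)..(1/2), (t ^ 2 + E)⁻¹ ≤ Real.pi * (E ^ ((1 : ℝ) / 2))⁻¹ := by
    have h1 := integral_inv_sq_add_sq_le (Real.sqrt_pos.2 hE) (-(1:ℝ)/2) (1/2)
    rwa [Real.sq_sqrt hE.le, Real.sqrt_eq_rpow] at h1
  calc _ ≤ ∫ t in (-(1:ℝ)/2)..(1/2),
          (a ^ ((n : ℝ) / 2))⁻¹ * (E ^ (((n : ℝ) - m - 2) / 2))⁻¹ * (t ^ 2 + E)⁻¹ := by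
        refine intervalIntegral.integral_mono_on (by norm_num) (hcont.intervalIntegrable _ _)
          ((hcont'.const_mul _).intervalIntegrable _ _) fun t ht => ?_
        exact abs_pow_mul_inv_rpow_le hmn ha hE
          (hbase t (abs_le.2 ⟨by linarith [ht.1], ht.2⟩))
    _ = (a ^ ((n : ℝ) / 2))⁻¹ * (E ^ (((n : ℝ) - m - 2) / 2))⁻¹ *
          ∫ t in (-(1:ℝ)/2)..(1/2), (t ^ 2 + E)⁻¹ := intervalIntegral.integral_const_mul _ _
    _ ≤ (a ^ ((n : ℝ) / 2))⁻¹ * (E ^ (((n : ℝ) - m - 2) / 2))⁻¹ *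
          (Real.pi * (E ^ ((1 : ℝ) / 2))⁻¹) := by gcongr
    _ = (a ^ ((n : ℝ) / 2))⁻¹ * Real.pi *
          ((E ^ (((n : ℝ) - m - 2) / 2))⁻¹ * (E ^ ((1 : ℝ) / 2))⁻¹) := by ring
    _ = (a ^ ((n : ℝ) / 2))⁻¹ * Real.pi * E ^ (((m : ℝ) + 1 - n) / 2) := by
        rw [← Real.rpow_neg hE.le, ← Real.rpow_neg hE.le, ← Real.rpow_add hE]
        congr 2
        ring
end
end

section
/- Leading-order asymptotics for even-power kernel integrals against C¹ densities: let m ≥ 0 be an even integer, n ≥ m + 3 an integer, and g ∈ C¹(ℝ/ℤ; ℝ³). Set d_{mn} = ∫_{−∞}^{∞} τ^m/(τ²+1)^{n/2} dτ. There exist constants C > 0 and ε₀ > 0, depending only on m, n, c_Γ, and κ_max, such that for all 0 < ε < ε₀, 0 < δ < ε₀, every s ∈ ℝ/ℤ and θ ∈ [0,2π), |∫_{−1/2}^{1/2} s̄^m / (|R(s,s̄,θ)|² + δ²)^{n/2} g(s̄) ds̄ − (ε² + δ²)^{(m+1−n)/2} d_{mn} g(0)| ≤ C (ε² + δ²)^{(m+2−n)/2}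 ‖g‖_{C¹}. -/
open MeasureTheory

noncomputable section

local notation "⟪" x ", " y "⟫" => @inner ℝ _ _ x y

lemma abs_pow_mul_sqrt_scaling (m k : ℕ) {e : ℝ} (he : 0 < e) (t : ℝ) :
    |e * t| ^ m * (√((e * t) ^ 2 + e ^ 2) ^ k)⁻¹
      = (e ^ m * (e ^ k)⁻¹) * (|t| ^ m * (√(t ^ 2 + 1) ^ k)⁻¹) := by
  have h : √((e * t) ^ 2 + e ^ 2) = e * √(t ^ 2 + 1) := by
    rw [show (e * t) ^ 2 + e ^ 2 = e ^ 2 * (t ^ 2 + 1) by ring,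
      Real.sqrt_mul (sq_nonneg e), Real.sqrt_sq he.le]
  rw [h, abs_mul, abs_of_pos he, mul_pow, mul_pow, mul_inv]
  ring

lemma integral_abs_pow_mul_sqrt_scaling (m k : ℕ) {e : ℝ} (he : 0 < e) :
    ∫ t : ℝ, |t| ^ m * (√(t ^ 2 + e ^ 2) ^ k)⁻¹
      = e ^ ((m : ℝ) + 1 - k) * ∫ t : ℝ, |t| ^ m * (√(t ^ 2 + 1) ^ k)⁻¹ := by
  have h := Measure.integral_comp_mul_left
    (fun t : ℝ => |t| ^ m * (√(t ^ 2 + e ^ 2) ^ k)⁻¹) e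
  simp only [abs_pow_mul_sqrt_scaling m k he] at h
  rw [integral_const_mul, abs_of_pos (inv_pos.2 he), smul_eq_mul] at h
  rw [Real.rpow_sub he, Real.rpow_add he, Real.rpow_natCast, Real.rpow_natCast, Real.rpow_one]
  have h2 : ∫ t : ℝ, |t| ^ m * (√(t ^ 2 + e ^ 2) ^ k)⁻¹
      = e * (e⁻¹ * ∫ t : ℝ, |t| ^ m * (√(t ^ 2 + e ^ 2) ^ k)⁻¹) := by
    field_simp
  rw [h2, ← h]
  ring

lemma integrable_abs_pow_mul_sqrt {m k : ℕ} (hk : m + 2 ≤ k) {e : ℝ} (he : 0 < e) :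
    Integrable fun t : ℝ => |t| ^ m * (√(t ^ 2 + e ^ 2) ^ k)⁻¹ := by
  rw [← integrable_comp_mul_left_iff _ he.ne']
  simp only [abs_pow_mul_sqrt_scaling m k he]
  refine Integrable.const_mul ?_ _
  refine integrable_inv_one_add_sq.mono' (by fun_prop) (ae_of_all _ fun t => ?_)
  have hp1 : 1 ≤ √(t ^ 2 + 1) := Real.one_le_sqrt.2 (by nlinarith [sq_nonneg t])
  have hp0 : 0 < √(t ^ 2 + 1) := by linarith
  have htp : |t| ≤ √(t ^ 2 + 1) := Real.abs_le_sqrt (by linarith)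
  rw [Real.norm_of_nonneg (by positivity), add_comm 1, ← div_eq_mul_inv,
    div_le_iff₀ (by positivity), ← div_eq_inv_mul, le_div_iff₀ (by positivity)]
  calc |t| ^ m * (t ^ 2 + 1) = |t| ^ m * √(t ^ 2 + 1) ^ 2 := by
        rw [Real.sq_sqrt (by positivity)]
    _ ≤ √(t ^ 2 + 1) ^ m * √(t ^ 2 + 1) ^ 2 := by gcongr
    _ = √(t ^ 2 + 1) ^ (m + 2) := by ring
    _ ≤ √(t ^ 2 + 1) ^ k := pow_le_pow_right₀ hp1 hk

lemma norm_le_C0norm {f : ℝ → V3} (hf : Continuous f) (hp : ∀ s, f (s + 1) = f s) (s : ℝ) :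
    ‖f s‖ ≤ C0norm f := by
  have hper : Function.Periodic f 1 := hp
  obtain ⟨M, hM⟩ := (hper.isBounded_of_continuous one_ne_zero hf).exists_norm_le
  exact le_ciSup (f := fun s => ‖f s‖)
    ⟨M, by rintro _ ⟨t, rfl⟩; exact hM _ ⟨t, rfl⟩⟩ s

lemma C0norm_nonneg (f : ℝ → V3) : 0 ≤ C0norm f :=
  Real.iSup_nonneg fun _ => norm_nonneg _

lemma norm_sub_zero_le_C0norm_deriv {g : ℝ → V3} (hg : ContDiff ℝ 1 g)
    (hp : ∀ s, g (s + 1) = g s) (t : ℝ) : ‖g t - g 0‖ ≤ C0norm (deriv g) * |t| := by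
  have hdp : ∀ s, deriv g (s + 1) = deriv g s := fun s => by
    rw [← deriv_comp_add_const]
    congr 1
    exact funext hp
  have h := Convex.norm_image_sub_le_of_norm_deriv_le (f := g) (s := Set.univ) (x := 0) (y := t)
    (fun x _ => hg.differentiable one_ne_zero x)
    (fun x _ => norm_le_C0norm (hg.continuous_deriv le_rfl) hdp x) convex_univ trivial trivial
  simpa using h

namespace SlenderGeom

variable {cΓ κmax : ℝ} {X en1 en2 : ℝ → V3}

lemma norm_sub_le (hX : SlenderGeom cΓ κmax X en1 en2) (s t : ℝ) :
    ‖X s - X (s - t)‖ ≤ |t| := by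
  have h := Convex.norm_image_sub_le_of_norm_deriv_le (f := X) (s := Set.univ) (x := s - t)
    (y := s) (fun x _ => hX.smooth.differentiable two_ne_zero x)
    (fun x _ => (hX.arclength x).le) convex_univ trivial trivial
  simpa using h

lemma norm_sub_tangent_le (hX : SlenderGeom cΓ κmax X en1 en2) (s t : ℝ) :
    ‖X s - X (s - t) - t • deriv X s‖ ≤ κmax * t ^ 2 := by
  have hd : Differentiable ℝ X := hX.smooth.differentiable two_ne_zero
  have hd2 : Differentiable ℝ (deriv X) :=
    ((contDiff_succ_iff_deriv (n := 1)).1 hX.smooth).2.2.differentiable one_ne_zero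
  have hκ : 0 ≤ κmax := (norm_nonneg _).trans (hX.curvature_max s)
  have h1 : ∀ a, ‖deriv X a - deriv X s‖ ≤ κmax * |a - s| := fun a => by
    simpa using Convex.norm_image_sub_le_of_norm_deriv_le (f := deriv X) (s := Set.univ)
      (x := s) (y := a) (fun x _ => hd2 x) (fun x _ => hX.curvature_max x) convex_univ
      trivial trivial
  have h2 := Convex.norm_image_sub_le_of_norm_hasDerivWithin_le
    (f := fun a => X a - a • deriv X s) (f' := fun a => deriv X a - deriv X s)
    (s := Set.uIcc (s - t) s) (x := s - t) (y := s) (C := κmax * |t|)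
    (fun a _ => by
      have := ((hd a).hasDerivAt.sub ((hasDerivAt_id a).smul_const (deriv X s)))
      rw [one_smul] at this
      exact this.hasDerivWithinAt)
    (fun a ha => (h1 a).trans (by
      refine mul_le_mul_of_nonneg_left ?_ hκ
      have := Set.abs_sub_right_of_mem_uIcc ha
      rw [abs_sub_comm]
      simpa using this))
    (convex_uIcc _ _) Set.left_mem_uIcc Set.right_mem_uIcc
  calc ‖X s - X (s - t) - t • deriv X s‖
      = ‖(X s - s • deriv X s) - (X (s - t) - (s - t) • deriv X s)‖ := by
        congr 1; rw [sub_smul]; abel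
    _ ≤ κmax * |t| * ‖s - (s - t)‖ := h2
    _ = κmax * t ^ 2 := by
        rw [sub_sub_cancel, Real.norm_eq_abs, mul_assoc, abs_mul_abs_self, sq]

lemma norm_ePerp_s7 (hX : SlenderGeom cΓ κmax X en1 en2) (s θ : ℝ) :
    ‖ePerp en1 en2 s θ‖ = 1 := by
  have h : ‖ePerp en1 en2 s θ‖ ^ 2 = 1 := by
    rw [ePerp, norm_add_sq_real, norm_smul, norm_smul, hX.en1_unit, hX.en2_unit,
      real_inner_smul_left, real_inner_smul_right, hX.en1_en2]
    simp
  exact (pow_eq_one_iff_of_nonneg (norm_nonneg _) two_ne_zero).1 h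

lemma inner_ePerp_tangent (hX : SlenderGeom cΓ κmax X en1 en2) (s θ : ℝ) :
    ⟪ePerp en1 en2 s θ, deriv X s⟫ = 0 := by
  rw [ePerp, real_inner_comm, inner_add_right, real_inner_smul_right, real_inner_smul_right,
    hX.es_en1, hX.es_en2]
  simp

lemma abs_inner_ePerp_le (hX : SlenderGeom cΓ κmax X en1 en2) (s t θ : ℝ) :
    |⟪ePerp en1 en2 s θ, X s - X (s - t)⟫| ≤ κmax * t ^ 2 := by
  have h : ⟪ePerp en1 en2 s θ, X s - X (s - t)⟫
      = ⟪ePerp en1 en2 s θ, X s - X (s - t) - t • deriv X s⟫ := by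
    rw [inner_sub_right _ _ (t • deriv X s), real_inner_smul_right, hX.inner_ePerp_tangent]
    simp
  rw [h]
  refine (abs_real_inner_le_norm _ _).trans ?_
  rw [hX.norm_ePerp_s7, one_mul]
  exact hX.norm_sub_tangent_le s t

lemma norm_Rvec_sq (hX : SlenderGeom cΓ κmax X en1 en2) (ε s t θ : ℝ) :
    ‖Rvec X en1 en2 ε s t θ‖ ^ 2 = ‖X s - X (s - t)‖ ^ 2
      + 2 * ε * ⟪ePerp en1 en2 s θ, X s - X (s - t)⟫ + ε ^ 2 := by
  rw [Rvec, show X s + ε • ePerp en1 en2 s θ - X (s - t)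
      = (X s - X (s - t)) + ε • ePerp en1 en2 s θ by abel, norm_add_sq_real, norm_smul,
    hX.norm_ePerp_s7, real_inner_smul_right, real_inner_comm, Real.norm_eq_abs, mul_one, sq_abs]
  ring

lemma abs_norm_Rvec_sq_sub_le (hX : SlenderGeom cΓ κmax X en1 en2) {ε : ℝ} (hε : 0 ≤ ε)
    (s t θ : ℝ) :
    |‖Rvec X en1 en2 ε s t θ‖ ^ 2 - (t ^ 2 + ε ^ 2)| ≤ 2 * κmax * t ^ 2 * (|t| + ε) := by
  have h1 : abs (‖X s - X (s - t)‖ - |t|) ≤ κmax * t ^ 2 := by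
    have h := abs_norm_sub_norm_le (X s - X (s - t)) (t • deriv X s)
    rw [norm_smul, hX.arclength, mul_one, Real.norm_eq_abs] at h
    exact h.trans (hX.norm_sub_tangent_le s t)
  have h2 : |‖X s - X (s - t)‖ ^ 2 - t ^ 2| ≤ κmax * t ^ 2 * (2 * |t|) := by
    rw [← sq_abs t, sq_sub_sq, abs_mul, mul_comm]
    rw [← sq_abs t] at h1
    refine mul_le_mul h1 ?_ (abs_nonneg _) ((abs_nonneg _).trans h1)
    rw [abs_of_nonneg (by positivity)]
    linarith [hX.norm_sub_le s t]
  have h3 := hX.abs_inner_ePerp_le s t θ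
  rw [hX.norm_Rvec_sq]
  rw [abs_le] at h2 h3 ⊢
  constructor <;> nlinarith [mul_le_mul_of_nonneg_left h3.1 hε,
    mul_le_mul_of_nonneg_left h3.2 hε]

lemma norm_Rvec_sq_ge (hX : SlenderGeom cΓ κmax X en1 en2) (hcΓ : 0 < cΓ) {ε : ℝ} (hε : 0 ≤ ε)
    (hεκ : 4 * ε * κmax ≤ cΓ ^ 2) (s θ : ℝ) {t : ℝ} (ht : |t| ≤ 1 / 2) :
    cΓ ^ 2 / 2 * t ^ 2 + ε ^ 2 ≤ ‖Rvec X en1 en2 ε s t θ‖ ^ 2 := by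
  have h1 : cΓ ^ 2 * t ^ 2 ≤ ‖X s - X (s - t)‖ ^ 2 := by
    have h := hX.no_self_intersect s (s - t) (by simpa using ht)
    rw [sub_sub_cancel] at h
    rw [← sq_abs t, ← mul_pow]
    gcongr
  have h3 := (abs_le.1 (hX.abs_inner_ePerp_le s t θ)).1
  rw [hX.norm_Rvec_sq]
  nlinarith [mul_le_mul_of_nonneg_left h3 hε, mul_le_mul_of_nonneg_right hεκ (sq_nonneg t)]

lemma continuous_Rvec (hX : SlenderGeom cΓ κmax X en1 en2) (ε s θ : ℝ) :
    Continuous fun t => Rvec X en1 en2 ε s t θ := by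
  have := hX.smooth.continuous
  unfold Rvec
  fun_prop

end SlenderGeom

/-- Comparison of inverse powers of `q` and `p` when `q² - p² = O(p³)` and `c p ≤ q`. -/
lemma abs_inv_pow_sub_inv_pow_le {p q c A : ℝ} (hp : 0 < p) (hc : 0 < c) (hc1 : c ≤ 1)
    (hq : c * p ≤ q) (hA : |q ^ 2 - p ^ 2| ≤ A * p ^ 3) (k : ℕ) :
    |(q ^ (k + 1))⁻¹ - (p ^ (k + 1))⁻¹|
      ≤ (A * (k + 1) * (c ^ (k + 1))⁻¹) * (p ^ k)⁻¹ := by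
  have hq0 : 0 < q := (mul_pos hc hp).trans_le hq
  have hqp : |q - p| ≤ A * p ^ 2 := by
    have h : |q - p| * p ≤ A * p ^ 2 * p := by
      calc |q - p| * p ≤ |q - p| * |q + p| := by
            gcongr; rw [abs_of_pos (by positivity)]; linarith
        _ = |q ^ 2 - p ^ 2| := by rw [← abs_mul]; congr 1; ring
        _ ≤ A * p ^ 2 * p := hA.trans_eq (by ring)
    exact le_of_mul_le_mul_right h hp
  have hA0 : 0 ≤ A :=
    nonneg_of_mul_nonneg_left ((abs_nonneg _).trans hqp) (by positivity)
  have hinv : |q⁻¹ - p⁻¹| ≤ A * c⁻¹ := by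
    rw [inv_sub_inv hq0.ne' hp.ne', abs_div, abs_of_pos (mul_pos hq0 hp), abs_sub_comm,
      div_le_iff₀ (by positivity)]
    calc |q - p| ≤ A * p ^ 2 := hqp
      _ = A * c⁻¹ * (c * p * p) := by field_simp
      _ ≤ A * c⁻¹ * (q * p) := by gcongr
  have hpq : p⁻¹ ≤ (c * p)⁻¹ := by
    gcongr
    nlinarith
  have hqq : q⁻¹ ≤ (c * p)⁻¹ := by gcongr
  have hmax : max |q⁻¹| |p⁻¹| ≤ (c * p)⁻¹ := by
    rw [abs_of_pos (by positivity), abs_of_pos (by positivity)]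
    exact max_le hqq hpq
  have hpow := abs_pow_sub_pow_le q⁻¹ p⁻¹ (k + 1)
  rw [inv_pow, inv_pow, Nat.add_sub_cancel] at hpow
  calc _ ≤ |q⁻¹ - p⁻¹| * ((k + 1 : ℕ) : ℝ) * max |q⁻¹| |p⁻¹| ^ k := hpow
    _ ≤ A * c⁻¹ * ((k + 1 : ℕ) : ℝ) * (c * p)⁻¹ ^ k := by
        gcongr
    _ = _ := by
        push_cast
        rw [mul_inv, mul_pow, inv_pow, inv_pow, pow_succ, mul_inv]
        ring

lemma norm_smul_sub_smul_le {E : Type*} [NormedAddCommGroup E] [NormedSpace ℝ E]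
    (a b : ℝ) (v w : E) : ‖a • v - b • w‖ ≤ |a - b| * ‖v‖ + |b| * ‖v - w‖ := by
  calc ‖a • v - b • w‖ = ‖(a - b) • v + b • (v - w)‖ := by
        congr 1; rw [sub_smul, smul_sub]; abel
    _ ≤ _ := by
        refine (norm_add_le _ _).trans ?_
        rw [norm_smul, norm_smul, Real.norm_eq_abs, Real.norm_eq_abs]

/-- Pointwise comparison, inside the period cell, of the exact kernel with its flat model. -/
lemma norm_kernel_sub_flat_le {cΓ κmax : ℝ} {X en1 en2 : ℝ → V3}
    (hX : SlenderGeom cΓ κmax X en1 en2) (hcΓ : 0 < cΓ) {c : ℝ} (hc : 0 < c) (hc1 : c ≤ 1)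
    (hcc : c ≤ cΓ / 2) {g : ℝ → V3} (hg : ContDiff ℝ 1 g) (hgp : ∀ s, g (s + 1) = g s)
    {ε δ : ℝ} (hε : 0 < ε) (hεκ : 4 * ε * κmax ≤ cΓ ^ 2) (s θ : ℝ) (m k : ℕ)
    {t : ℝ} (ht : |t| ≤ 1 / 2) :
    ‖(|t| ^ m * (√(‖Rvec X en1 en2 ε s t θ‖ ^ 2 + δ ^ 2) ^ (k + 1))⁻¹) • g t
        - (|t| ^ m * (√(t ^ 2 + (ε ^ 2 + δ ^ 2)) ^ (k + 1))⁻¹) • g 0‖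
      ≤ ((4 * κmax * (k + 1) * (c ^ (k + 1))⁻¹) * C0norm g + C0norm (deriv g))
          * (|t| ^ m * (√(t ^ 2 + (ε ^ 2 + δ ^ 2)) ^ k)⁻¹) := by
  set p := √(t ^ 2 + (ε ^ 2 + δ ^ 2))
  set q := √(‖Rvec X en1 en2 ε s t θ‖ ^ 2 + δ ^ 2)
  have hp : 0 < p := Real.sqrt_pos.2 (by positivity)
  have hp2 : p ^ 2 = t ^ 2 + (ε ^ 2 + δ ^ 2) := Real.sq_sqrt (by positivity)
  have hq2 : q ^ 2 = ‖Rvec X en1 en2 ε s t θ‖ ^ 2 + δ ^ 2 := Real.sq_sqrt (by positivity)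
  have htp : |t| ≤ p := Real.abs_le_sqrt (by nlinarith [sq_nonneg ε, sq_nonneg δ])
  have hεp : ε ≤ p := Real.le_sqrt_of_sq_le (by nlinarith [sq_nonneg t, sq_nonneg δ])
  have hκ : 0 ≤ κmax := (norm_nonneg _).trans (hX.curvature_max s)
  have hlow := hX.norm_Rvec_sq_ge hcΓ hε.le hεκ s θ ht
  have hcp : c * p ≤ q := by
    refine Real.le_sqrt_of_sq_le ?_
    have h1 : c ^ 2 ≤ 1 := pow_le_one₀ hc.le hc1
    have h2 : c ^ 2 ≤ cΓ ^ 2 / 2 := by nlinarith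
    rw [mul_pow, hp2]
    nlinarith [mul_le_mul_of_nonneg_right h2 (sq_nonneg t),
      mul_le_mul_of_nonneg_right h1 (add_nonneg (sq_nonneg ε) (sq_nonneg δ))]
  have hA : |q ^ 2 - p ^ 2| ≤ 4 * κmax * p ^ 3 := by
    have h := hX.abs_norm_Rvec_sq_sub_le hε.le s t θ
    calc |q ^ 2 - p ^ 2| = |‖Rvec X en1 en2 ε s t θ‖ ^ 2 - (t ^ 2 + ε ^ 2)| := by
          rw [hq2, hp2]; congr 1; ring
      _ ≤ 2 * κmax * |t| ^ 2 * (|t| + ε) := by rwa [sq_abs]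
      _ ≤ 2 * κmax * p ^ 2 * (p + p) := by gcongr
      _ = 4 * κmax * p ^ 3 := by ring
  have hinv := abs_inv_pow_sub_inv_pow_le hp hc hc1 hcp hA k
  have hg0 := norm_le_C0norm hg.continuous hgp t
  have hg1 := norm_sub_zero_le_C0norm_deriv hg hgp t
  have hG1 := C0norm_nonneg (deriv g)
  refine (norm_smul_sub_smul_le _ _ _ _).trans ?_
  rw [← mul_sub, abs_mul, abs_of_nonneg (by positivity : 0 ≤ |t| ^ m),
    abs_of_nonneg (by positivity : 0 ≤ |t| ^ m * (p ^ (k + 1))⁻¹)]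
  calc _ ≤ |t| ^ m * ((4 * κmax * (k + 1) * (c ^ (k + 1))⁻¹) * (p ^ k)⁻¹) * C0norm g
        + |t| ^ m * (p ^ (k + 1))⁻¹ * (C0norm (deriv g) * p) := by
        gcongr
        exact hg1.trans (by gcongr)
    _ = _ := by
        field_simp
        ring

/-- Outside the period cell the flat model gains one power of decay. -/
lemma flat_tail_le {E t : ℝ} (hE : 0 < E) (ht : 1 / 2 ≤ |t|) (m k : ℕ) :
    |t| ^ m * (√(t ^ 2 + E) ^ (k + 1))⁻¹ ≤ 2 * (|t| ^ m * (√(t ^ 2 + E) ^ k)⁻¹) := by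
  have hp : 0 < √(t ^ 2 + E) := Real.sqrt_pos.2 (by positivity)
  have htp : |t| ≤ √(t ^ 2 + E) := Real.abs_le_sqrt (by linarith)
  have h : (√(t ^ 2 + E))⁻¹ ≤ 2 := by
    rw [inv_le_comm₀ hp two_pos]
    linarith
  calc |t| ^ m * (√(t ^ 2 + E) ^ (k + 1))⁻¹
      = (√(t ^ 2 + E))⁻¹ * (|t| ^ m * (√(t ^ 2 + E) ^ k)⁻¹) := by
        rw [pow_succ, mul_inv]; ring
    _ ≤ _ := by gcongr

/-- Leading-order asymptotics for even-power kernel integrals against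
`C¹` densities: for even `m ≥ 0` and `n ≥ m+3`, with `d_{mn} = ∫_ℝ τ^m/(τ²+1)^{n/2} dτ`,
the integral equals `(ε²+δ²)^{(m+1−n)/2} d_{mn} g(0)` up to
`C (ε²+δ²)^{(m+2−n)/2} ‖g‖_{C¹}`. -/
theorem kernel_integral_even_asymptotics (m n : ℕ) (hm : Even m) (hmn : m + 3 ≤ n)
    (cΓ κmax : ℝ) (hcΓ : 0 < cΓ) :
    ∃ C > 0, ∃ ε₀ > 0,
      ∀ X en1 en2 : ℝ → V3, SlenderGeom cΓ κmax X en1 en2 →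
      ∀ g : ℝ → V3, ContDiff ℝ 1 g → (∀ s, g (s + 1) = g s) →
      ∀ ε δ : ℝ, 0 < ε → ε < ε₀ → 0 < δ → δ < ε₀ →
      ∀ s θ : ℝ,
        ‖(∫ sb in (-(1:ℝ)/2)..(1/2),
              (sb ^ m * ((‖Rvec X en1 en2 ε s sb θ‖ ^ 2 + δ ^ 2) ^ ((n : ℝ) / 2))⁻¹)
                • g sb)
            - ((ε ^ 2 + δ ^ 2) ^ (((m : ℝ) + 1 - n) / 2)
                * ∫ τ : ℝ, τ ^ m * ((τ ^ 2 + 1) ^ ((n : ℝ) / 2))⁻¹) • g 0‖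
          ≤ C * (ε ^ 2 + δ ^ 2) ^ (((m : ℝ) + 2 - n) / 2) * C1norm g := by
  obtain ⟨k, rfl⟩ : ∃ k, n = k + 1 := ⟨n - 1, by omega⟩
  have hk : m + 2 ≤ k := by omega
  set c : ℝ := min 1 (cΓ / 2)
  have hc : 0 < c := lt_min one_pos (by positivity)
  set A : ℝ := 4 * |κmax| * (k + 1) * (c ^ (k + 1))⁻¹ with hAdef
  have hA : 0 ≤ A := by positivity
  set J : ℝ := ∫ t : ℝ, |t| ^ m * (√(t ^ 2 + 1) ^ k)⁻¹ with hJdef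
  have hJ : 0 ≤ J := integral_nonneg fun t => by positivity
  refine ⟨(A + 2) * J + 1, by positivity, cΓ ^ 2 / (4 * (|κmax| + 1)), by positivity, ?_⟩
  intro X en1 en2 hX g hg hgp ε δ hε hεlt hδ _ s θ
  have hκ : 0 ≤ κmax := (norm_nonneg _).trans (hX.curvature_max s)
  rw [abs_of_nonneg hκ] at hεlt hAdef
  have hεκ : 4 * ε * κmax ≤ cΓ ^ 2 := by
    rw [lt_div_iff₀ (by positivity)] at hεlt
    nlinarith
  have hE : 0 < ε ^ 2 + δ ^ 2 := by positivity
  set e : ℝ := √(ε ^ 2 + δ ^ 2) with hedef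
  have he : 0 < e := Real.sqrt_pos.2 hE
  have he2 : e ^ 2 = ε ^ 2 + δ ^ 2 := Real.sq_sqrt hE.le
  have hint1 := integrable_abs_pow_mul_sqrt (m := m) (k := k + 1) (by omega) he
  have hint2 := integrable_abs_pow_mul_sqrt hk he
  have hscale1 := integral_abs_pow_mul_sqrt_scaling m (k + 1) he
  have hscale2 := integral_abs_pow_mul_sqrt_scaling m k he
  rw [he2] at hint1 hint2 hscale1 hscale2
  set F : ℝ → V3 := fun t =>
    (|t| ^ m * (√(‖Rvec X en1 en2 ε s t θ‖ ^ 2 + δ ^ 2) ^ (k + 1))⁻¹) • g t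
  have hFcont : Continuous F := by
    have hR := hX.continuous_Rvec ε s θ
    have hgc := hg.continuous
    have hq : Continuous fun t => √(‖Rvec X en1 en2 ε s t θ‖ ^ 2 + δ ^ 2) ^ (k + 1) := by
      fun_prop
    refine ((continuous_abs.pow m).mul (hq.inv₀ fun t => ?_)).smul hgc
    have : 0 < √(‖Rvec X en1 en2 ε s t θ‖ ^ 2 + δ ^ 2) := Real.sqrt_pos.2 (by positivity)
    positivity
  have hfirst : (∫ sb in (-(1:ℝ)/2)..(1/2),
      (sb ^ m * ((‖Rvec X en1 en2 ε s sb θ‖ ^ 2 + δ ^ 2) ^ (((k + 1 : ℕ) : ℝ) / 2))⁻¹) • g sb)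
      = ∫ t, (Set.Ioc (-(1:ℝ)/2) (1/2)).indicator F t := by
    rw [intervalIntegral.integral_of_le (by norm_num), integral_indicator measurableSet_Ioc]
    congr 1
    funext t
    rw [Real.rpow_div_two_eq_sqrt _ (by positivity), Real.rpow_natCast, ← hm.pow_abs]
  have hsecond : ((ε ^ 2 + δ ^ 2) ^ (((m : ℝ) + 1 - (k + 1 : ℕ)) / 2)
      * ∫ τ : ℝ, τ ^ m * ((τ ^ 2 + 1) ^ (((k + 1 : ℕ) : ℝ) / 2))⁻¹) • g 0
      = ∫ t : ℝ, (|t| ^ m * (√(t ^ 2 + (ε ^ 2 + δ ^ 2)) ^ (k + 1))⁻¹) • g 0 := by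
    rw [integral_smul_const, hscale1, Real.rpow_div_two_eq_sqrt _ hE.le]
    congr 3
    funext t
    rw [Real.rpow_div_two_eq_sqrt _ (by positivity), Real.rpow_natCast, hm.pow_abs]
  have hFint : Integrable ((Set.Ioc (-(1:ℝ)/2) (1/2)).indicator F) :=
    (integrable_indicator_iff measurableSet_Ioc).2
      ((hFcont.integrableOn_Icc).mono_set Set.Ioc_subset_Icc_self)
  rw [hfirst, hsecond, ← integral_sub hFint (hint1.smul_const _)]
  have hG0 := C0norm_nonneg g
  have hG1 := C0norm_nonneg (deriv g)
  have hbound : ∀ t : ℝ, ‖(Set.Ioc (-(1:ℝ)/2) (1/2)).indicator F t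
      - (|t| ^ m * (√(t ^ 2 + (ε ^ 2 + δ ^ 2)) ^ (k + 1))⁻¹) • g 0‖
      ≤ ((A + 2) * C1norm g) * (|t| ^ m * (√(t ^ 2 + (ε ^ 2 + δ ^ 2)) ^ k)⁻¹) := by
    intro t
    by_cases ht : t ∈ Set.Ioc (-(1:ℝ)/2) (1/2)
    · rw [Set.indicator_of_mem ht]
      have ht' : |t| ≤ 1 / 2 := abs_le.2 ⟨by linarith [ht.1], ht.2⟩
      refine (norm_kernel_sub_flat_le hX hcΓ hc (min_le_left _ _) (min_le_right _ _) hg hgp hε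
        hεκ s θ m k ht').trans ?_
      rw [← hAdef]
      refine mul_le_mul_of_nonneg_right ?_ (by positivity)
      rw [C1norm]
      nlinarith [mul_nonneg hA hG1]
    · rw [Set.indicator_of_notMem ht, zero_sub, norm_neg, norm_smul,
        Real.norm_of_nonneg (by positivity)]
      have ht' : 1 / 2 ≤ |t| := by
        by_contra! h
        exact ht ⟨by linarith [(abs_lt.1 h).1], (abs_lt.1 h).2.le⟩
      calc _ ≤ 2 * (|t| ^ m * (√(t ^ 2 + (ε ^ 2 + δ ^ 2)) ^ k)⁻¹) * C0norm g := by
            exact mul_le_mul (flat_tail_le hE ht' m k) (norm_le_C0norm hg.continuous hgp 0)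
              (norm_nonneg _) (by positivity)
        _ = (2 * C0norm g) * (|t| ^ m * (√(t ^ 2 + (ε ^ 2 + δ ^ 2)) ^ k)⁻¹) := by ring
        _ ≤ _ := by
            refine mul_le_mul_of_nonneg_right ?_ (by positivity)
            rw [C1norm]
            nlinarith [mul_nonneg hA hG1, mul_nonneg hA hG0]
  have hC1 : 0 ≤ C1norm g := add_nonneg hG0 hG1
  refine (norm_integral_le_of_norm_le (hint2.const_mul _) (ae_of_all _ hbound)).trans ?_
  rw [integral_const_mul, hscale2, Real.rpow_div_two_eq_sqrt _ hE.le, ← hedef, ← hJdef,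
    show (m : ℝ) + 2 - (k + 1 : ℕ) = (m : ℝ) + 1 - k by push_cast; ring]
  have hpos : 0 ≤ e ^ ((m : ℝ) + 1 - k) * C1norm g := by positivity
  linarith
end
end

section
/- The difference between the periodic and flat singular kernels integrates exactly: ∫_{−1/2}^{1/2} ( 1/|sin(π s)/π| − 1/|s| ) ds = 2 log(4/π), where the integrand extends continuously to s = 0 (both singularities cancel) and the integral is absolutely convergent. -/
open MeasureTheory

lemma hasDerivAt_log_sinc_sub_log_cos {s : ℝ} (hs : s ∈ Set.Ioo (0 : ℝ) (1 / 2)) :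
    HasDerivAt
      (fun t : ℝ => Real.log (Real.sinc (Real.pi / 2 * t)) - Real.log (Real.cos (Real.pi / 2 * t)))
      (Real.pi / |Real.sin (Real.pi * s)| - 1 / |s|) s := by
  obtain ⟨h0, h1⟩ := hs
  have hpi := Real.pi_pos
  have hx : 0 < Real.pi / 2 * s := by positivity
  have hsin : 0 < Real.sin (Real.pi / 2 * s) := Real.sin_pos_of_pos_of_lt_pi hx (by nlinarith)
  have hcos : 0 < Real.cos (Real.pi / 2 * s) :=
    Real.cos_pos_of_mem_Ioo ⟨by linarith, by nlinarith⟩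
  have hlin : HasDerivAt (fun t : ℝ => Real.pi / 2 * t) (Real.pi / 2) s := by
    simpa using (hasDerivAt_id s).const_mul (Real.pi / 2)
  have hderiv := ((hlin.sin.div hlin hx.ne').log (div_pos hsin hx).ne').sub
    (hlin.cos.log hcos.ne')
  have hsin_two :
      Real.sin (Real.pi * s) = 2 * Real.sin (Real.pi / 2 * s) * Real.cos (Real.pi / 2 * s) := by
    rw [← Real.sin_two_mul]
    ring_nf
  refine (hderiv.congr_of_eventuallyEq ?_).congr_deriv ?_
  · filter_upwards [lt_mem_nhds h0] with t ht
    simp [Real.sinc_of_ne_zero (show Real.pi / 2 * t ≠ 0 by positivity)]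
  · rw [hsin_two, abs_of_pos (by positivity), abs_of_pos h0]
    have := Real.sin_sq_add_cos_sq (Real.pi / 2 * s)
    simp only [Pi.div_apply]
    generalize Real.sin (Real.pi / 2 * s) = u at *
    generalize Real.cos (Real.pi / 2 * s) = v at *
    field_simp
    linear_combination (Real.pi * s) * this

lemma continuousOn_log_sinc_sub_log_cos :
    ContinuousOn
      (fun t : ℝ => Real.log (Real.sinc (Real.pi / 2 * t)) - Real.log (Real.cos (Real.pi / 2 * t)))
      (Set.Icc 0 (1 / 2)) := by
  have hpi := Real.pi_pos
  refine ContinuousOn.sub (ContinuousOn.log ?_ ?_) (ContinuousOn.log (by fun_prop) ?_)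
  · exact (Real.continuous_sinc.comp (by fun_prop)).continuousOn
  · rintro t ⟨h0, h1⟩
    rcases h0.eq_or_lt with rfl | h0
    · simp
    · have hx : 0 < Real.pi / 2 * t := by positivity
      rw [Real.sinc_of_ne_zero hx.ne']
      exact (div_pos (Real.sin_pos_of_pos_of_lt_pi hx (by nlinarith)) hx).ne'
  · rintro t ⟨h0, h1⟩
    exact (Real.cos_pos_of_mem_Ioo ⟨by nlinarith, by nlinarith⟩).ne'

lemma periodic_minus_flat_kernel_nonneg {s : ℝ} (hs : s ∈ Set.Ioo (0 : ℝ) (1 / 2)) :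
    0 ≤ Real.pi / |Real.sin (Real.pi * s)| - 1 / |s| := by
  obtain ⟨h0, h1⟩ := hs
  have hpi := Real.pi_pos
  have hx : 0 < Real.pi * s := by positivity
  have hsin : 0 < Real.sin (Real.pi * s) := Real.sin_pos_of_pos_of_lt_pi hx (by nlinarith)
  rw [abs_of_pos hsin, abs_of_pos h0, sub_nonneg, div_le_div_iff₀ h0 hsin, one_mul]
  exact Real.sin_le hx.le

lemma intervalIntegrable_periodic_minus_flat_kernel :
    IntervalIntegrable (fun s : ℝ => Real.pi / |Real.sin (Real.pi * s)| - 1 / |s|)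
      volume 0 (1 / 2) := by
  refine intervalIntegral.intervalIntegrable_deriv_of_nonneg
    (g := fun t : ℝ =>
      Real.log (Real.sinc (Real.pi / 2 * t)) - Real.log (Real.cos (Real.pi / 2 * t)))
    ?_ ?_ ?_
  · rw [Set.uIcc_of_le (by norm_num)]
    exact continuousOn_log_sinc_sub_log_cos
  · intro s hs
    exact hasDerivAt_log_sinc_sub_log_cos (by simpa using hs)
  · intro s hs
    exact periodic_minus_flat_kernel_nonneg (by simpa using hs)

lemma integral_periodic_minus_flat_kernel_half :
    (∫ s in (0 : ℝ)..(1 / 2), (Real.pi / |Real.sin (Real.pi * s)| - 1 / |s|))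
      = Real.log (4 / Real.pi) := by
  rw [intervalIntegral.integral_eq_sub_of_hasDerivAt_of_le (by norm_num)
    continuousOn_log_sinc_sub_log_cos (fun s hs => hasDerivAt_log_sinc_sub_log_cos hs)
    intervalIntegrable_periodic_minus_flat_kernel]
  have hpi := Real.pi_pos
  have hx : Real.pi / 2 * (1 / 2) = Real.pi / 4 := by ring
  rw [hx, Real.sinc_of_ne_zero (by positivity), Real.sin_pi_div_four, Real.cos_pi_div_four,
    ← Real.log_div (by positivity) (by positivity)]
  simp only [mul_zero, Real.sinc_zero, Real.cos_zero, Real.log_one, sub_zero]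
  congr 1
  field_simp

/-- The difference between the periodic and flat singular kernels is
absolutely integrable on `[−1/2, 1/2]` and integrates exactly:
`∫_{−1/2}^{1/2} (π/|sin(π s)| − 1/|s|) ds = 2 log(4/π)`. -/
theorem periodic_minus_flat_kernel_integral :
    IntervalIntegrable (fun s : ℝ => Real.pi / |Real.sin (Real.pi * s)| - 1 / |s|)
      volume (-(1/2)) (1/2) ∧
    (∫ s in (-(1:ℝ)/2)..(1/2), (Real.pi / |Real.sin (Real.pi * s)| - 1 / |s|))
      = 2 * Real.log (4 / Real.pi) := by
  have hpos := intervalIntegrable_periodic_minus_flat_kernel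
  have hneg : IntervalIntegrable (fun s : ℝ => Real.pi / |Real.sin (Real.pi * s)| - 1 / |s|)
      volume (-(1 / 2)) 0 := by
    simpa using ((IntervalIntegrable.iff_comp_neg).1 hpos).symm
  refine ⟨hneg.trans hpos, ?_⟩
  have hint := intervalIntegral.integral_comp_neg (a := 0) (b := 1 / 2)
    (fun s : ℝ => Real.pi / |Real.sin (Real.pi * s)| - 1 / |s|)
  simp only [mul_neg, Real.sin_neg, abs_neg, neg_zero] at hint
  rw [neg_div, ← intervalIntegral.integral_add_adjacent_intervals hneg hpos, ← hint,
    integral_periodic_minus_flat_kernel_half, two_mul]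
end
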